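/- If X is a compact Hausdorff topological space that is homogeneous and has countable tightness, then the cardinality of X is at most 2^(2^ℵ₀). -/

import Mathlib

open Cardinal Topology

universe u

open Set

theorem exists_wellOrder_countable_initial_segments :
    ∃ (W : Type) (_ : LinearOrder W) (_ : WellFoundedLT W), #W ≤ 2 ^ ℵ₀ ∧
      Nonempty W ∧ (∀ i : W, (Iio i).Countable) ∧ ∀ f : ℕ → W, ∃ i, ∀ n, f n < i := by
  have hIio (i : (ℵ₁ : Cardinal.{0}).ord.ToType) : (Iio i).Countable := by
    have : #(Iio i) < #((ℵ₁ : Cardinal.{0}).ord.ToType) := mk_Iio_lt i (by simp)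
    rw [mk_ord_toType] at this
    exact le_aleph0_iff_set_countable.1 (lt_aleph_one_iff.1 this)
  refine ⟨(ℵ₁ : Cardinal.{0}).ord.ToType, inferInstance, inferInstance, ?_, ?_, hIio,
    fun f => ?_⟩
  · rw [mk_ord_toType]
    exact aleph_one_le_continuum
  · rw [← mk_ne_zero_iff, mk_ord_toType]
    exact (aleph_pos 1).ne'
  · by_contra! h
    have huniv : (univ : Set (ℵ₁ : Cardinal.{0}).ord.ToType).Countable := by
      refine (countable_iUnion fun n => ((hIio (f n)).insert (f n))).mono fun i _ => ?_
      obtain ⟨n, hn⟩ := h i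
      rw [mem_iUnion]
      exact ⟨n, hn.eq_or_lt⟩
    rw [← le_aleph0_iff_set_countable, mk_univ, mk_ord_toType] at huniv
    exact huniv.not_gt aleph0_lt_aleph_one

theorem mk_iUnion_le_of_le {ι : Type*} {α : Type u} {κ : Cardinal.{u}} (hκ : ℵ₀ ≤ κ)
    (f : ι → Set α) (hι : lift.{u} #ι ≤ lift κ) (hf : ∀ i, #(f i) ≤ κ) :
    #(⋃ i, f i) ≤ κ := by
  rw [← lift_le]
  refine (mk_iUnion_le_lift f).trans ?_
  refine (mul_le_mul' hι (ciSup_le' fun i => lift_le.2 (hf i))).trans ?_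
  exact (mul_eq_self (by simpa using hκ)).le

theorem exists_small_closed_under_sequences {α : Type u} {κ : Cardinal.{u}}
    (hκ : 2 ^ ℵ₀ ≤ κ) (hpow : κ ^ ℵ₀ = κ) (F : (ℕ → α) → Set α)
    (hF : ∀ s, #(F s) ≤ κ) (x₀ : α) :
    ∃ H : Set α, x₀ ∈ H ∧ #H ≤ κ ∧ ∀ s : ℕ → α, (∀ n, s n ∈ H) → F s ⊆ H := by
  obtain ⟨W, _, _, hW, ⟨i₀⟩, -, hbdd⟩ := exists_wellOrder_countable_initial_segments
  have hκ₀ : ℵ₀ ≤ κ := (cantor ℵ₀).le.trans hκ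
  have hWκ : lift.{u} #W ≤ lift.{0} κ := by
    refine (lift_le.{u}.2 hW).trans ?_
    simpa using hκ
  let step (P : Set α) : Set α := insert x₀ (⋃ s : ℕ → P, F fun n => s n)
  let stage : W → Set α := WellFoundedLT.fix fun i prev => step (⋃ j : Iio i, prev j j.2)
  have stage_eq (i : W) : stage i = step (⋃ j : Iio i, stage j) :=
    WellFoundedLT.fix_eq _ i
  have hstage (i : W) : #(stage i) ≤ κ := by
    induction i using WellFoundedLT.induction with
    | ind i ih =>
      have hP : #(⋃ j : Iio i, stage j) ≤ κ := by
        refine mk_iUnion_le_of_le hκ₀ _ ?_ fun j => ih j j.2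
        exact (lift_le.2 (mk_set_le _)).trans hWκ
      rw [stage_eq]
      refine (mk_insert_le).trans ?_
      refine add_le_of_le hκ₀ ?_ (one_le_aleph0.trans hκ₀)
      refine mk_iUnion_le_of_le hκ₀ _ ?_ fun s => hF _
      rw [lift_le, mk_arrow, mk_nat, lift_aleph0, lift_id'.{0, u}]
      exact (power_le_power_right hP).trans hpow.le
  refine ⟨⋃ i, stage i, mem_iUnion.2 ⟨i₀, ?_⟩, mk_iUnion_le_of_le hκ₀ _ hWκ hstage, ?_⟩
  · rw [stage_eq]
    exact mem_insert _ _
  · intro s hs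
    choose i hi using fun n => mem_iUnion.1 (hs n)
    obtain ⟨k, hk⟩ := hbdd i
    refine Subset.trans ?_ (subset_iUnion stage k)
    rw [stage_eq]
    refine Subset.trans ?_ (subset_insert _ _)
    exact subset_iUnion_of_subset
      (fun n => ⟨s n, mem_iUnion.2 ⟨⟨i n, hk n⟩, hi n⟩⟩) Subset.rfl

theorem mk_closure_range_le {X : Type u} [TopologicalSpace X] [T2Space X] (s : ℕ → X) :
    #(closure (range s)) ≤ 2 ^ ((2 : Cardinal.{u}) ^ ℵ₀) := by
  let φ : closure (range s) → Set (Set ℕ) := fun y => {A | (y : X) ∈ closure (s '' A)}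
  have hφ : Function.Injective φ := by
    intro y z hyz
    by_contra hne
    obtain ⟨U, V, hU, hV, hyU, hzV, hUV⟩ := t2_separation (Subtype.coe_ne_coe.2 hne)
    have hy : s ⁻¹' U ∈ φ y := by
      change (y : X) ∈ closure (s '' (s ⁻¹' U))
      rw [image_preimage_eq_inter_range]
      exact hU.inter_closure ⟨hyU, y.2⟩
    rw [hyz] at hy
    obtain ⟨w, hwV, n, hn, rfl⟩ := mem_closure_iff.1 hy V hV hzV
    exact hUV.le_bot ⟨hn, hwV⟩
  simpa using lift_mk_le_lift_mk_of_injective hφ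

theorem exists_isClosed_isGδ_of_notMem {X : Type*} [TopologicalSpace X] [NormalSpace X]
    [T1Space X] {C : Set X} (hC : IsClosed C) {y : X} (hy : y ∉ C) :
    ∃ Z : Set X, IsClosed Z ∧ IsGδ Z ∧ y ∈ Z ∧ Disjoint Z C := by
  obtain ⟨f, hf₀, hf₁, -⟩ := exists_continuous_zero_one_of_isClosed
    (isClosed_singleton (x := y)) hC (disjoint_singleton_left.2 hy)
  refine ⟨f ⁻¹' {0}, isClosed_singleton.preimage f.continuous,
    isClosed_singleton.isGδ.preimage f.continuous, hf₀ rfl, ?_⟩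
  refine disjoint_left.2 fun z hz hzC => ?_
  have h₁ : f z = 1 := hf₁ hzC
  have h₀ : f z = 0 := hz
  simp [h₀] at h₁

theorem exists_isGδ_subset_closure_countable {X : Type*} [TopologicalSpace X] [CompactSpace X]
    [T2Space X] [Nonempty X]
    (tight : ∀ (A : Set X) (x : X), x ∈ closure A →
      ∃ B ⊆ A, B.Countable ∧ x ∈ closure B) :
    ∃ G S : Set X, IsGδ G ∧ G.Nonempty ∧ S.Countable ∧ G ⊆ closure S := by
  by_contra! hcon
  obtain ⟨W, _, _, -, _, hIio, hbdd⟩ := exists_wellOrder_countable_initial_segments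
  have hstep (S G : Set X) : ∃ p : X × Set X, S.Countable → IsGδ G → IsClosed G → G.Nonempty →
      IsClosed p.2 ∧ IsGδ p.2 ∧ p.1 ∈ p.2 ∧ p.2 ⊆ G ∧ Disjoint p.2 (closure S) := by
    by_cases h : S.Countable ∧ IsGδ G ∧ IsClosed G ∧ G.Nonempty
    · obtain ⟨hS, hG, hGc, hGne⟩ := h
      obtain ⟨y, hyG, hyS⟩ := not_subset.1 (hcon G S hG hGne hS)
      obtain ⟨Z, hZc, hZ, hyZ, hZS⟩ := exists_isClosed_isGδ_of_notMem isClosed_closure hyS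
      exact ⟨(y, G ∩ Z), fun _ _ _ _ => ⟨hGc.inter hZc, hG.inter hZ, ⟨hyG, hyZ⟩,
        inter_subset_left, hZS.mono_left inter_subset_right⟩⟩
    · exact ⟨(Classical.arbitrary X, ∅), fun h₁ h₂ h₃ h₄ => absurd ⟨h₁, h₂, h₃, h₄⟩ h⟩
  choose step hstep using hstep
  let d : W → X × Set X := WellFoundedLT.fix fun i prev =>
    step (range fun j : Iio i => (prev j j.2).1) (⋂ j : Iio i, (prev j j.2).2)
  have d_eq (i : W) : d i = step (range fun j : Iio i => (d j).1) (⋂ j : Iio i, (d j).2) :=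
    WellFoundedLT.fix_eq _ i
  have hd (i : W) : IsClosed (d i).2 ∧ IsGδ (d i).2 ∧ (d i).1 ∈ (d i).2 ∧
      (d i).2 ⊆ ⋂ j : Iio i, (d j).2 ∧
      Disjoint (d i).2 (closure (range fun j : Iio i => (d j).1)) := by
    induction i using WellFoundedLT.induction with
    | ind i ih =>
      have : Countable (Iio i) := (hIio i).to_subtype
      have hne : (⋂ j : Iio i, (d j).2).Nonempty := by
        rcases isEmpty_or_nonempty (Iio i) with h | h
        · simp
        refine IsCompact.nonempty_iInter_of_directed_nonempty_isCompact_isClosed _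
          (directed_of_isDirected_le fun j k hjk => ?_) (fun j => ⟨_, (ih j j.2).2.2.1⟩)
          (fun j => (ih j j.2).1.isCompact) fun j => (ih j j.2).1
        rcases hjk.eq_or_lt with rfl | hlt
        · exact Subset.rfl
        · exact (ih k k.2).2.2.2.1.trans (iInter_subset_of_subset ⟨j, hlt⟩ Subset.rfl)
      have h := hstep (range fun j : Iio i => (d j).1) (⋂ j : Iio i, (d j).2)
        (countable_range _) (IsGδ.iInter fun j => (ih j j.2).2.1)
        (isClosed_iInter fun j => (ih j j.2).1) hne
      rwa [← d_eq] at h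
  have hanti {i j : W} (hij : i ≤ j) : (d j).2 ⊆ (d i).2 := by
    rcases hij.eq_or_lt with rfl | hlt
    · exact Subset.rfl
    · exact (hd j).2.2.2.1.trans (iInter_subset_of_subset ⟨i, hlt⟩ Subset.rfl)
  let T (i : W) : Set X := closure ((fun j => (d j).1) '' Ici i)
  obtain ⟨z, hz⟩ : (⋂ i, T i).Nonempty :=
    IsCompact.nonempty_iInter_of_directed_nonempty_isCompact_isClosed _
      (directed_of_isDirected_le fun i j hij => closure_mono (image_mono (Ici_subset_Ici.2 hij)))
      (fun i => ⟨_, subset_closure ⟨i, self_mem_Ici, rfl⟩⟩)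
      (fun i => isClosed_closure.isCompact) fun i => isClosed_closure
  rw [mem_iInter] at hz
  have hzG (i : W) : z ∈ (d i).2 := by
    refine closure_minimal ?_ (hd i).1 (hz i)
    rintro _ ⟨j, hj, rfl⟩
    exact hanti hj (hd j).2.2.1
  obtain ⟨A, hA, hAc, hzA⟩ := tight (range fun j => (d j).1) z
    (closure_mono (image_subset_range _ _) (hz (Classical.arbitrary W)))
  have hAne : A.Nonempty := closure_nonempty_iff.1 ⟨z, hzA⟩
  obtain ⟨s, rfl⟩ := hAc.exists_eq_range hAne
  choose f hf using fun n => hA (mem_range_self n)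
  obtain ⟨i, hi⟩ := hbdd f
  refine (hd i).2.2.2.2.le_bot ⟨hzG i, closure_mono ?_ hzA⟩
  rintro _ ⟨n, rfl⟩
  exact ⟨⟨f n, hi n⟩, hf n⟩

theorem exists_openFamily_iInter_eq_singleton {X : Type*} [TopologicalSpace X]
    [T2Space X] {G S : Set X} (hG : IsGδ G) (hS : S.Countable) (hGS : G ⊆ closure S)
    {x : X} (hx : x ∈ G) :
    ∃ B : ℕ ⊕ Set ℕ → Set X, (∀ t, IsOpen (B t)) ∧ (∀ t, x ∈ B t) ∧
      ∀ y ≠ x, ∃ t, y ∉ B t := by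
  obtain ⟨U, hU, rfl⟩ := isGδ_iff_eq_iInter_nat.1 hG
  have hSne : S.Nonempty := closure_nonempty_iff.1 ⟨x, hGS hx⟩
  obtain ⟨s, rfl⟩ := hS.exists_eq_range hSne
  refine ⟨Sum.elim U fun A => {z | x ∉ closure (s '' A) → z ∉ closure (s '' A)}, ?_, ?_, ?_⟩
  · rintro (n | A)
    · exact hU n
    · by_cases hA : x ∈ closure (s '' A)
      · simp [hA]
      · have h : IsOpen (closure (s '' A))ᶜ := isClosed_closure.isOpen_compl
        simpa [hA, compl_def] using h
  · rintro (n | A)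
    · exact mem_iInter.1 hx n
    · exact id
  · intro y hyx
    by_cases hy : y ∈ ⋂ n, U n
    · obtain ⟨V, hV, hVc, hxV⟩ : ∃ V : Set X, IsOpen V ∧ y ∈ V ∧ x ∉ closure V := by
        obtain ⟨V, V', hV, hV', hyV, hxV', hd⟩ := t2_separation hyx
        refine ⟨V, hV, hyV, fun hxV => ?_⟩
        exact (hd.closure_left hV').le_bot ⟨hxV, hxV'⟩
      refine ⟨Sum.inr (s ⁻¹' V), fun h => ?_⟩
      refine h (fun hx' => hxV (closure_mono (image_preimage_subset s V) hx')) ?_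
      rw [image_preimage_eq_inter_range]
      exact hV.inter_closure ⟨hVc, hGS hy⟩
    · obtain ⟨n, hn⟩ := not_forall.1 (mt mem_iInter.2 hy)
      exact ⟨Sum.inl n, hn⟩

theorem mk_le_of_compact_of_openFamilies {X : Type u} [TopologicalSpace X] [CompactSpace X]
    [T2Space X] (tight : ∀ (A : Set X) (x : X), x ∈ closure A →
      ∃ B ⊆ A, B.Countable ∧ x ∈ closure B)
    (B : X → ℕ ⊕ Set ℕ → Set X) (hB : ∀ x t, IsOpen (B x t)) (hxB : ∀ x t, x ∈ B x t)
    (hsep : ∀ x, ∀ y ≠ x, ∃ t, y ∉ B x t) :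
    #X ≤ 2 ^ ((2 : Cardinal.{u}) ^ ℵ₀) := by
  rcases isEmpty_or_nonempty X with hX | ⟨⟨x₀⟩⟩
  · simp
  have hc : ℵ₀ ≤ (2 : Cardinal.{u}) ^ ℵ₀ := (cantor ℵ₀).le
  have hcκ : (2 : Cardinal.{u}) ^ ℵ₀ ≤ 2 ^ ((2 : Cardinal.{u}) ^ ℵ₀) := (cantor _).le
  have hpow : ((2 : Cardinal.{u}) ^ ((2 : Cardinal.{u}) ^ ℵ₀)) ^ ℵ₀ =
      2 ^ ((2 : Cardinal.{u}) ^ ℵ₀) := by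
    rw [← power_mul, mul_eq_left hc hc aleph0_ne_zero]
  have hpick (s : ℕ → X) (t : ℕ → ℕ ⊕ Set ℕ) :
      ∃ z, (∃ y, y ∉ ⋃ n, B (s n) (t n)) → z ∉ ⋃ n, B (s n) (t n) := by
    by_cases h : ∃ y, y ∉ ⋃ n, B (s n) (t n)
    · exact h.imp fun y hy _ => hy
    · exact ⟨x₀, fun h' => absurd h' h⟩
  choose pick hpick using hpick
  obtain ⟨H, hx₀, hHcard, hH⟩ := exists_small_closed_under_sequences hcκ hpow
    (fun s => closure (range s) ∪ range (pick s)) (fun s => by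
      refine (mk_union_le _ _).trans (add_le_of_le (hc.trans hcκ) (mk_closure_range_le s) ?_)
      rw [← lift_le.{0}]
      refine mk_range_le_lift.trans ?_
      have : #(ℕ → ℕ ⊕ Set ℕ) = 2 ^ ℵ₀ := by simp
      rw [this]
      simpa using hcκ) x₀
  have hclosed : IsClosed H := by
    refine isClosed_of_closure_subset fun x hx => ?_
    obtain ⟨A, hAH, hA, hxA⟩ := tight H x hx
    obtain ⟨s, rfl⟩ := hA.exists_eq_range (closure_nonempty_iff.1 ⟨x, hxA⟩)
    exact hH s (fun n => hAH ⟨n, rfl⟩) (Or.inl hxA)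
  suffices H = Set.univ by rwa [this, mk_univ] at hHcard
  refine eq_univ_of_forall fun p => ?_
  by_contra hp
  have hsep' (x : H) : ∃ t, p ∉ B x t := hsep x p fun h => hp (h ▸ x.2)
  choose t ht using hsep'
  obtain ⟨T, hT⟩ := hclosed.isCompact.elim_finite_subcover (fun x : H => B x (t x))
    (fun x => hB _ _) fun x hx => mem_iUnion.2 ⟨⟨x, hx⟩, hxB _ _⟩
  obtain ⟨x, hxT, -⟩ := mem_iUnion₂.1 (hT hx₀)
  obtain ⟨e, he⟩ := T.countable_toSet.exists_eq_range ⟨x, hxT⟩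
  have hmem : pick (fun n => e n) (fun n => t (e n)) ∈ H :=
    hH (fun n => e n) (fun n => (e n).2) (Or.inr ⟨_, rfl⟩)
  refine hpick (fun n => e n) (fun n => t (e n)) ⟨p, ?_⟩ ?_
  · simpa using fun n => ht (e n)
  · obtain ⟨y, hyT, hy⟩ := mem_iUnion₂.1 (hT hmem)
    obtain ⟨n, rfl⟩ : y ∈ range e := he ▸ hyT
    exact mem_iUnion.2 ⟨n, hy⟩

/-- Countable tightness, homogeneity and compact Hausdorff imply
|X| ≤ 2^(2^ℵ₀). -/
theorem cardinality_le_two_pow_continuum_of_compact_homogeneous_countably_tight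
    (X : Type*) [TopologicalSpace X] [CompactSpace X] [T2Space X]
    (homog : ∀ x y : X, ∃ f : X ≃ₜ X, f x = y)
    (tight : ∀ (A : Set X) (x : X), x ∈ closure A →
      ∃ B ⊆ A, B.Countable ∧ x ∈ closure B) :
    Cardinal.mk X ≤ 2 ^ ((2 : Cardinal) ^ Cardinal.aleph0) := by
  rcases isEmpty_or_nonempty X with hX | hX
  · simp
  obtain ⟨G, S, hG, ⟨x, hx⟩, hS, hGS⟩ := exists_isGδ_subset_closure_countable tight
  obtain ⟨B, hB, hxB, hsep⟩ := exists_openFamily_iInter_eq_singleton hG hS hGS hx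
  choose f hf using fun y => homog y x
  refine mk_le_of_compact_of_openFamilies tight (fun y t => f y ⁻¹' B t)
    (fun y t => (hB t).preimage (f y).continuous) (fun y t => ?_) fun y z hz => ?_
  · simpa [hf] using hxB t
  · refine hsep (f y z) fun h => hz ((f y).injective (h.trans (hf y).symm))
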